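/- Let n ≥ 2 be an integer and let A ∈ Σ_{n²} be an S-permutation matrix. Then the number ξ_n of S-permutation matrices B ∈ Σ_{n²} that are disjoint from A does not depend on A and equals Σ over all n×n binary matrices C with ε(C) ≥ 2 of (−1)^{ε(C)} ∏_{i=0}^{n} [(n−i)!]^{ψ_i(C)}. -/

import Mathlib

def IsSPermMatrix (n : ℕ) (A : Fin n × Fin n → Fin n × Fin n → Fin 2) : Prop :=
  (∀ r : Fin n × Fin n, ∃! c : Fin n × Fin n, A r c = 1) ∧
  (∀ c : Fin n × Fin n, ∃! r : Fin n × Fin n, A r c = 1) ∧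
  (∀ i k : Fin n, ∃! p : Fin n × Fin n, A (i, p.1) (k, p.2) = 1)

def DisjointBin (n : ℕ) (A B : Fin n × Fin n → Fin n × Fin n → Fin 2) : Prop :=
  ∀ r c : Fin n × Fin n, ¬(A r c = 1 ∧ B r c = 1)

def rowCount (n : ℕ) (C : Fin n → Fin n → Fin 2) (k : ℕ) : ℕ :=
  (Finset.univ.filter fun i : Fin n =>
    (Finset.univ.filter fun j : Fin n => C i j = 1).card = k).card

def colCount (n : ℕ) (C : Fin n → Fin n → Fin 2) (k : ℕ) : ℕ :=
  (Finset.univ.filter fun j : Fin n =>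
    (Finset.univ.filter fun i : Fin n => C i j = 1).card = k).card

def psi (n : ℕ) (C : Fin n → Fin n → Fin 2) (k : ℕ) : ℕ :=
  rowCount n C k + colCount n C k

def eps (n : ℕ) (C : Fin n → Fin n → Fin 2) : ℕ :=
  (Finset.univ.filter fun p : Fin n × Fin n => C p.1 p.2 = 1).card

/-- The binary matrix with a one at `((i, j), (k, l))` exactly when the permutation attached to
the band of rows `i` sends `k` to `j` and the one attached to the band of columns `k` sends `i`
to `l`. -/
def permMatrix {n : ℕ}
    (x : (Fin n → Equiv.Perm (Fin n)) × (Fin n → Equiv.Perm (Fin n))) :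
    Fin n × Fin n → Fin n × Fin n → Fin 2 :=
  fun r c => if x.1 r.1 c.1 = r.2 ∧ x.2 c.1 r.1 = c.2 then 1 else 0

theorem permMatrix_eq_one_iff {n : ℕ}
    (x : (Fin n → Equiv.Perm (Fin n)) × (Fin n → Equiv.Perm (Fin n)))
    (r c : Fin n × Fin n) :
    permMatrix x r c = 1 ↔ x.1 r.1 c.1 = r.2 ∧ x.2 c.1 r.1 = c.2 := by
  unfold permMatrix
  split_ifs with h <;> simp [h]

theorem permMatrix_injective {n : ℕ} : Function.Injective (permMatrix (n := n)) := by
  intro x y h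
  have key : ∀ i k, y.1 i k = x.1 i k ∧ y.2 k i = x.2 k i := by
    intro i k
    have h1 : permMatrix x (i, x.1 i k) (k, x.2 k i) = 1 := by
      simp [permMatrix_eq_one_iff]
    rw [h, permMatrix_eq_one_iff] at h1
    exact h1
  refine Prod.ext ?_ ?_
  · funext i
    ext1 k
    exact (key i k).1.symm
  · funext k
    ext1 i
    exact (key i k).2.symm

theorem isSPermMatrix_permMatrix {n : ℕ}
    (x : (Fin n → Equiv.Perm (Fin n)) × (Fin n → Equiv.Perm (Fin n))) :
    IsSPermMatrix n (permMatrix x) := by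
  refine ⟨?_, ?_, ?_⟩
  · rintro ⟨i, j⟩
    refine ⟨((x.1 i).symm j, x.2 ((x.1 i).symm j) i), by simp [permMatrix_eq_one_iff], ?_⟩
    rintro ⟨k, l⟩ h
    obtain ⟨h1, h2⟩ := (permMatrix_eq_one_iff _ _ _).1 h
    dsimp only at h1 h2
    subst h1 h2
    simp
  · rintro ⟨k, l⟩
    refine ⟨((x.2 k).symm l, x.1 ((x.2 k).symm l) k), by simp [permMatrix_eq_one_iff], ?_⟩
    rintro ⟨i, j⟩ h
    obtain ⟨h1, h2⟩ := (permMatrix_eq_one_iff _ _ _).1 h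
    dsimp only at h1 h2
    subst h1 h2
    simp
  · intro i k
    refine ⟨(x.1 i k, x.2 k i), by simp [permMatrix_eq_one_iff], ?_⟩
    rintro ⟨j, l⟩ h
    obtain ⟨h1, h2⟩ := (permMatrix_eq_one_iff _ _ _).1 h
    exact Prod.ext h1.symm h2.symm

theorem IsSPermMatrix.exists_permMatrix_eq {n : ℕ}
    {A : Fin n × Fin n → Fin n × Fin n → Fin 2} (hA : IsSPermMatrix n A) :
    ∃ x, permMatrix x = A := by
  obtain ⟨hrow, hcol, hblock⟩ := hA
  choose f hf hu using hblock
  have hσ : ∀ i, Function.Injective fun k => (f i k).1 := by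
    intro i k k' h
    have h1 := hf i k
    have h2 := hf i k'
    dsimp only at h h1 h2
    rw [← h] at h2
    exact congrArg Prod.fst ((hrow _).unique h1 h2)
  have hτ : ∀ k, Function.Injective fun i => (f i k).2 := by
    intro k i i' h
    have h1 := hf i k
    have h2 := hf i' k
    dsimp only at h h1 h2
    rw [← h] at h2
    exact congrArg Prod.fst ((hcol _).unique h1 h2)
  refine ⟨(fun i => Equiv.ofBijective _ (Finite.injective_iff_bijective.1 (hσ i)),
    fun k => Equiv.ofBijective _ (Finite.injective_iff_bijective.1 (hτ k))), ?_⟩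
  have fin_two : ∀ a b : Fin 2, (a = 1 ↔ b = 1) → a = b := by decide
  funext ⟨i, j⟩ ⟨k, l⟩
  apply fin_two
  rw [permMatrix_eq_one_iff]
  simp only [Equiv.ofBijective_apply]
  constructor
  · rintro ⟨rfl, rfl⟩
    exact hf i k
  · intro h
    rw [← hu i k (j, l) h]
    exact ⟨rfl, rfl⟩

theorem disjointBin_permMatrix_iff {n : ℕ}
    (x y : (Fin n → Equiv.Perm (Fin n)) × (Fin n → Equiv.Perm (Fin n))) :
    DisjointBin n (permMatrix x) (permMatrix y) ↔
      ∀ i k, ¬(y.1 i k = x.1 i k ∧ y.2 k i = x.2 k i) := by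
  constructor
  · intro h i k hik
    exact h (i, x.1 i k) (k, x.2 k i) (by simpa [permMatrix_eq_one_iff] using hik)
  · rintro h ⟨i, j⟩ ⟨k, l⟩ ⟨h1, h2⟩
    rw [permMatrix_eq_one_iff] at h1 h2
    exact h i k ⟨h2.1.trans h1.1.symm, h2.2.trans h1.2.symm⟩

/-- The number of permutations agreeing with a given one on a set of `s` points of an `n`-point
type is `(n - s)!`. -/
theorem card_perm_agreeing {α : Type*} [Fintype α] [DecidableEq α] (σ : Equiv.Perm α)
    (p : α → Prop) [DecidablePred p] :
    (Finset.univ.filter fun τ : Equiv.Perm α => ∀ a, p a → τ a = σ a).card =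
      (Fintype.card α - (Finset.univ.filter p).card).factorial := by
  rw [← Fintype.card_subtype p, ← Fintype.card_subtype_compl, ← Fintype.card_perm,
    ← Fintype.card_subtype]
  refine Fintype.card_congr
    (Equiv.trans (Equiv.subtypeEquiv (Equiv.mulLeft σ⁻¹) fun τ => ?_)
      (Equiv.Perm.subtypeEquivSubtypePerm fun a => ¬ p a).symm)
  simp [Equiv.symm_apply_eq]

theorem sum_prod_perm_agreeing {n : ℕ} (σ : Fin n → Equiv.Perm (Fin n))
    (p : Fin n → Fin n → Prop) [∀ i, DecidablePred (p i)] :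
    ∑ τ : Fin n → Equiv.Perm (Fin n),
        (∏ i, ∏ k, if p i k → τ i k = σ i k then (1 : ℤ) else 0) =
      ∏ i, ((n - (Finset.univ.filter (p i)).card).factorial : ℤ) := by
  rw [← Fintype.piFinset_univ, ← Finset.prod_univ_sum (fun _ => Finset.univ)
    fun i (τ : Equiv.Perm (Fin n)) => ∏ k, if p i k → τ k = σ i k then (1 : ℤ) else 0]
  refine Finset.prod_congr rfl fun i _ => ?_
  have h := card_perm_agreeing (σ i) (p i)
  rw [Fintype.card_fin] at h
  rw [← h, Finset.card_filter]
  push_cast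
  refine Finset.sum_congr rfl fun τ _ => ?_
  rw [Finset.prod_ite_zero]
  simp

theorem prod_factorial_pow_psi {n : ℕ} (C : Fin n → Fin n → Fin 2) :
    ∏ i ∈ Finset.range (n + 1), ((Nat.factorial (n - i) : ℤ)) ^ (psi n C i) =
      (∏ i, ((n - (Finset.univ.filter fun k => C i k = 1).card).factorial : ℤ)) *
      ∏ k, ((n - (Finset.univ.filter fun i => C i k = 1).card).factorial : ℤ) := by
  have key : ∀ g : Fin n → ℕ, (∀ i, g i ≤ n) →
      ∏ i, ((n - g i).factorial : ℤ) = ∏ m ∈ Finset.range (n + 1),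
        ((Nat.factorial (n - m) : ℤ)) ^ (Finset.univ.filter fun i => g i = m).card := by
    intro g hg
    rw [← Finset.prod_fiberwise_of_maps_to (s := Finset.univ) (t := Finset.range (n + 1))
      (g := g) fun i _ => Finset.mem_range.2 (Nat.lt_succ_of_le (hg i))]
    refine Finset.prod_congr rfl fun m _ => Finset.prod_eq_pow_card fun i hi => ?_
    rw [(Finset.mem_filter.1 hi).2]
  rw [key _ fun i => by simpa using Finset.card_filter_le Finset.univ fun k => C i k = 1,
    key _ fun k => by simpa using Finset.card_filter_le Finset.univ fun i => C i k = 1,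
    ← Finset.prod_mul_distrib]
  refine Finset.prod_congr rfl fun m _ => ?_
  rw [psi, pow_add, rowCount, colCount]

theorem neg_one_pow_eps {n : ℕ} (C : Fin n → Fin n → Fin 2) :
    (-1 : ℤ) ^ eps n C = ∏ i, ∏ k, if C i k = 1 then (-1 : ℤ) else 1 := by
  rw [← Fintype.prod_prod_type' fun i k => if C i k = 1 then (-1 : ℤ) else 1,
    Finset.prod_ite]
  simp [eps]

/-- Expansion over binary matrices of the indicator that no entry satisfies `p`. -/
theorem indicator_forall_not_eq_sum {n : ℕ} (p : Fin n → Fin n → Prop)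
    [∀ i, DecidablePred (p i)] :
    (if ∀ i k, ¬ p i k then (1 : ℤ) else 0) =
      ∑ C : Fin n → Fin n → Fin 2,
        (-1) ^ eps n C * ∏ i, ∏ k, if C i k = 1 → p i k then (1 : ℤ) else 0 := by
  simp only [neg_one_pow_eps, ← Finset.prod_mul_distrib]
  let F : Fin n → Fin n → Fin 2 → ℤ := fun i k c =>
    (if c = 1 then (-1 : ℤ) else 1) * if c = 1 → p i k then (1 : ℤ) else 0
  have h1 : ∑ C : Fin n → Fin n → Fin 2, ∏ i, ∏ k, F i k (C i k) =
      ∏ i, ∏ k, ∑ c, F i k c := by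
    rw [← Fintype.piFinset_univ, ← Finset.prod_univ_sum (fun _ => Finset.univ)
      fun i (c : Fin n → Fin 2) => ∏ k, F i k (c k)]
    refine Finset.prod_congr rfl fun i _ => ?_
    rw [← Fintype.piFinset_univ, ← Finset.prod_univ_sum (fun _ => Finset.univ)]
  have h2 : ∀ i k, ∑ c, F i k c = if ¬ p i k then 1 else 0 := by
    intro i k
    by_cases h : p i k <;> simp [F, h]
  change _ = ∑ C : Fin n → Fin n → Fin 2, ∏ i, ∏ k, F i k (C i k)
  simp only [h1, h2, Finset.prod_ite_zero, Finset.prod_const_one, Finset.mem_univ, true_imp_iff]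

theorem card_disjoint_eq_sum {n : ℕ} {A : Fin n × Fin n → Fin n × Fin n → Fin 2}
    (hA : IsSPermMatrix n A) :
    (Nat.card {B : Fin n × Fin n → Fin n × Fin n → Fin 2 //
        IsSPermMatrix n B ∧ DisjointBin n A B} : ℤ) =
      ∑ C : Fin n → Fin n → Fin 2, (-1 : ℤ) ^ (eps n C) *
        ((∏ i, ((n - (Finset.univ.filter fun k => C i k = 1).card).factorial : ℤ)) *
        ∏ k, ((n - (Finset.univ.filter fun i => C i k = 1).card).factorial : ℤ)) := by
  obtain ⟨x, rfl⟩ := hA.exists_permMatrix_eq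
  have hcard : Nat.card {B : Fin n × Fin n → Fin n × Fin n → Fin 2 //
        IsSPermMatrix n B ∧ DisjointBin n (permMatrix x) B} =
      Nat.card {y : (Fin n → Equiv.Perm (Fin n)) × (Fin n → Equiv.Perm (Fin n)) //
        ∀ i k, ¬(y.1 i k = x.1 i k ∧ y.2 k i = x.2 k i)} := by
    symm
    refine Nat.card_congr (Equiv.ofBijective (fun y => ⟨permMatrix y.1,
      isSPermMatrix_permMatrix _, (disjointBin_permMatrix_iff _ _).2 y.2⟩) ⟨?_, ?_⟩)
    · intro y z h
      exact Subtype.ext (permMatrix_injective (congrArg Subtype.val h))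
    · rintro ⟨B, hB, hd⟩
      obtain ⟨y, rfl⟩ := hB.exists_permMatrix_eq
      exact ⟨⟨y, (disjointBin_permMatrix_iff _ _).1 hd⟩, rfl⟩
  rw [hcard, Nat.card_eq_fintype_card, Fintype.card_subtype, Finset.card_filter]
  push_cast
  simp only [indicator_forall_not_eq_sum]
  rw [Finset.sum_comm]
  refine Finset.sum_congr rfl fun C _ => ?_
  rw [← Finset.mul_sum, ← sum_prod_perm_agreeing x.1 fun i k => C i k = 1,
    ← sum_prod_perm_agreeing x.2 fun k i => C i k = 1, Finset.sum_mul_sum,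
    ← Fintype.sum_prod_type']
  refine congrArg _ (Finset.sum_congr rfl fun y _ => ?_)
  rw [Finset.prod_comm (f := fun k i => if C i k = 1 → y.2 k i = x.2 k i then (1 : ℤ) else 0)]
  simp only [← Finset.prod_mul_distrib]
  refine Finset.prod_congr rfl fun i _ => Finset.prod_congr rfl fun k _ => ?_
  split_ifs <;> first | rfl | (exfalso; tauto)

/-- The contributions of the binary matrices with at most one entry equal to one cancel. -/
theorem sum_eps_lt_two_eq_zero {n : ℕ} (hn : n ≠ 0) :
    ∑ C ∈ Finset.univ.filter (fun C : Fin n → Fin n → Fin 2 => ¬ 2 ≤ eps n C),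
      (-1 : ℤ) ^ (eps n C) *
        ((∏ i, ((n - (Finset.univ.filter fun k => C i k = 1).card).factorial : ℤ)) *
        ∏ k, ((n - (Finset.univ.filter fun i => C i k = 1).card).factorial : ℤ)) = 0 := by
  let E : Fin n × Fin n → Fin n → Fin n → Fin 2 := fun p i k => if p = (i, k) then 1 else 0
  have hE1 : ∀ p i k, E p i k = 1 ↔ p = (i, k) := by
    intro p i k
    by_cases h : p = (i, k) <;> simp [E, h]
  have hEinj : Function.Injective E := by
    intro p q h
    have h1 : E p p.1 p.2 = 1 := (hE1 _ _ _).2 rfl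
    rw [h, hE1] at h1
    exact h1.symm
  have hEeps : ∀ p, eps n (E p) = 1 := by
    intro p
    simp [eps, hE1, Finset.filter_eq]
  have h0eps : eps n (fun _ _ => 0) = 0 := by simp [eps]
  have fin_two : ∀ a b : Fin 2, (a = 1 ↔ b = 1) → a = b := by decide
  have hset : Finset.univ.filter (fun C : Fin n → Fin n → Fin 2 => ¬ 2 ≤ eps n C) =
      insert (fun _ _ => 0) (Finset.univ.image E) := by
    ext C
    simp only [Finset.mem_filter, Finset.mem_univ, true_and, Finset.mem_insert,
      Finset.mem_image]
    constructor
    · intro h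
      obtain h | h : eps n C = 0 ∨ eps n C = 1 := by omega
      · left
        rw [eps, Finset.card_eq_zero, Finset.filter_eq_empty_iff] at h
        funext i k
        exact fin_two _ _ (by simpa using h (Finset.mem_univ (i, k)))
      · right
        obtain ⟨p, hp⟩ := Finset.card_eq_one.1 h
        refine ⟨p, ?_⟩
        funext i k
        apply fin_two
        have := Finset.ext_iff.1 hp (i, k)
        simp only [Finset.mem_filter, Finset.mem_univ, true_and, Finset.mem_singleton] at this
        rw [this, hE1, eq_comm]
    · rintro (rfl | ⟨p, rfl⟩)
      · omega
      · rw [hEeps]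
        omega
  have hnot : (fun _ _ => 0) ∉ Finset.univ.image E := by
    simp only [Finset.mem_image, Finset.mem_univ, true_and, not_exists]
    intro p hp
    have := hEeps p
    rw [hp, h0eps] at this
    omega
  have hprod : ∀ (g : Fin n → ℕ) (a : Fin n), (∀ i, g i = if a = i then 1 else 0) →
      ∏ i, ((n - g i).factorial : ℤ) = (n - 1).factorial * (n.factorial : ℤ) ^ (n - 1) := by
    intro g a hg
    rw [← Finset.mul_prod_erase _ _ (Finset.mem_univ a), hg a, if_pos rfl]
    congr 1
    rw [Finset.prod_eq_pow_card (b := (n.factorial : ℤ)), Finset.card_erase_of_mem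
      (Finset.mem_univ a), Finset.card_univ, Fintype.card_fin]
    intro i hi
    rw [hg, if_neg (Finset.ne_of_mem_erase hi).symm, Nat.sub_zero]
  have hrow : ∀ p i, (Finset.univ.filter fun k => E p i k = 1).card =
      if p.1 = i then 1 else 0 := by
    rintro ⟨a, b⟩ i
    by_cases h : a = i <;> simp [hE1, h, Finset.filter_eq]
  have hcol : ∀ p k, (Finset.univ.filter fun i => E p i k = 1).card =
      if p.2 = k then 1 else 0 := by
    rintro ⟨a, b⟩ k
    by_cases h : b = k <;> simp [hE1, h, Finset.filter_eq]
  rw [hset, Finset.sum_insert hnot, Finset.sum_image hEinj.injOn, h0eps]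
  simp only [hEeps, hprod _ _ (hrow _), hprod _ _ (hcol _)]
  obtain ⟨m, rfl⟩ := Nat.exists_eq_succ_of_ne_zero hn
  simp [Nat.factorial_succ]
  ring

/-- For `n ≥ 2` and any S-permutation matrix `A`, the number `ξ_n` of S-permutation
matrices disjoint from `A` does not depend on `A` and equals
`Σ_{C, ε(C) ≥ 2} (−1)^{ε(C)} ∏_{i=0}^{n} [(n−i)!]^{ψ_i(C)}`. -/
theorem count_disjoint_sperm (n : ℕ) (hn : 2 ≤ n)
    (A : Fin n × Fin n → Fin n × Fin n → Fin 2) (hA : IsSPermMatrix n A) :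
    (Nat.card {B : Fin n × Fin n → Fin n × Fin n → Fin 2 //
        IsSPermMatrix n B ∧ DisjointBin n A B} : ℤ) =
      ∑ C ∈ Finset.univ.filter (fun C : Fin n → Fin n → Fin 2 => 2 ≤ eps n C),
        (-1 : ℤ) ^ (eps n C) *
          ∏ i ∈ Finset.range (n + 1), ((Nat.factorial (n - i) : ℤ)) ^ (psi n C i) := by
  simp only [prod_factorial_pow_psi]
  rw [card_disjoint_eq_sum hA,
    ← Finset.sum_filter_add_sum_filter_not _ fun C : Fin n → Fin n → Fin 2 => 2 ≤ eps n C,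
    sum_eps_lt_two_eq_zero (by omega), add_zero]
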